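/- arXiv:1703.07111 — 2 statements merged into one kernel-verified Lean document; each statement's English description precedes it below -/
import Mathlib

section
/- Let H be a norm of class I_p with p > 1 on ℝ^N and let H_0 be its dual norm; set V = H^p/p. Then for every ξ ∈ ℝ^N with ξ ≠ 0 the Hessian ∇_ξ²V(ξ) is invertible and its inverse has entries (∇_ξ²V(ξ))^{-1}_{ij} = (H(ξ)^{2−p}/(p−1)) · ( ∂_{η_i}H_0(∇_ξH(ξ)) ∂_{η_j}H_0(∇_ξH(ξ)) + (p−1) ∂²_{η_iη_j}H_0(∇_ξH(ξ)) ). -/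
open MeasureTheory Filter Set
open scoped Topology RealInnerProductSpace NNReal

noncomputable section

abbrev Euc (N : ℕ) := EuclideanSpace ℝ (Fin N)

variable {N : ℕ}

/-- The partial derivative of `f` in the `i`-th coordinate direction. -/
def pd (i : Fin N) (f : Euc N → ℝ) (x : Euc N) : ℝ :=
  fderiv ℝ f x (EuclideanSpace.single i 1)

/-- The Hessian matrix of `f` at `x`. -/
def hessM (f : Euc N → ℝ) (x : Euc N) : Matrix (Fin N) (Fin N) ℝ :=
  Matrix.of fun i j => pd i (pd j f) x

/-- Interpret a plain function `Fin N → ℝ` as a point of Euclidean space. -/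
def toEuc {N : ℕ} (f : Fin N → ℝ) : Euc N := (WithLp.equiv 2 (Fin N → ℝ)).symm f

/-- The divergence of a vector field. -/
def divVF (X : Euc N → Euc N) (x : Euc N) : ℝ := ∑ i, pd i (fun y => X y i) x

/-- The quadratic form associated to a matrix. -/
def qForm (A : Matrix (Fin N) (Fin N) ℝ) (ζ : Euc N) : ℝ := ∑ i, ∑ j, A i j * ζ i * ζ j

/-- Local `α`-Hölder continuity of `g` on `s` (uniform on compact subsets). -/
def LocHolderOn {X Y : Type*} [NormedAddCommGroup X] [NormedAddCommGroup Y]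
    (α : ℝ) (g : X → Y) (s : Set X) : Prop :=
  ∀ K : Set X, K ⊆ s → IsCompact K → ∃ C : ℝ, ∀ x ∈ K, ∀ y ∈ K, ‖g x - g y‖ ≤ C * ‖x - y‖ ^ α

/-- The dual norm `H₀(x) = sup_{ξ ≠ 0} ⟨x, ξ⟩ / H(ξ)`. -/
def dualNorm (H : Euc N → ℝ) (x : Euc N) : ℝ :=
  ⨆ ξ : {ξ : Euc N // ξ ≠ 0}, ⟪x, (ξ : Euc N)⟫ / H ξ

/-- `V = H^p / p`. -/
def Vfun (H : Euc N → ℝ) (p : ℝ) : Euc N → ℝ := fun ξ => H ξ ^ p / p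

/-- `H` is a norm of class `I_p`: a norm which is `C^{2,α}` away from the origin, for some
`α ∈ (0,1)`, such that `V = H^p/p` is `C²` away from the origin with Hessian having positive
eigenvalues uniformly bounded away from `0` on the unit sphere. -/
structure IsIpNorm (p : ℝ) (H : Euc N → ℝ) : Prop where
  convex : ConvexOn ℝ Set.univ H
  homog : ∀ (t : ℝ) (ξ : Euc N), H (t • ξ) = |t| * H ξ
  pos : ∀ ξ : Euc N, ξ ≠ 0 → 0 < H ξ
  smooth : ContDiffOn ℝ 2 H {(0 : Euc N)}ᶜ
  holder : ∃ α ∈ Set.Ioo (0:ℝ) 1,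
    LocHolderOn α (iteratedFDerivWithin ℝ 2 H {(0 : Euc N)}ᶜ) {(0 : Euc N)}ᶜ
  Vsmooth : ContDiffOn ℝ 2 (Vfun H p) {(0 : Euc N)}ᶜ
  hessV_pos : ∃ c > 0, ∀ ξ : Euc N, ‖ξ‖ = 1 → ∀ ζ : Euc N,
    c * ‖ζ‖ ^ 2 ≤ qForm (hessM (Vfun H p) ξ) ζ

/-- `Ω` is, up to a translation, the Wulff shape `B_{H₀}(r)` of `H` for some `r > 0`. -/
def IsWulffShape (H : Euc N → ℝ) (Ω : Set (Euc N)) : Prop :=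
  ∃ (x₀ : Euc N) (r : ℝ), 0 < r ∧ Ω = {x | dualNorm H (x - x₀) < r}

/-- An open set with boundary of class `C^{2,α}`, described by a `C^{2,α}` defining function. -/
def IsC2alphaDomain (Ω : Set (Euc N)) : Prop :=
  IsOpen Ω ∧ ∃ f : Euc N → ℝ, ContDiff ℝ 2 f ∧
    (∃ α ∈ Set.Ioo (0:ℝ) 1, LocHolderOn α (iteratedFDeriv ℝ 2 f) (Set.univ : Set (Euc N))) ∧
    Ω = {x | f x < 0} ∧ frontier Ω = {x | f x = 0} ∧
    ∀ x ∈ frontier Ω, gradient f x ≠ 0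

/-- Weak solution of `Δ_p^H u = -1` in `Ω`, `u = 0` on `∂Ω`. -/
structure IsInteriorSol (H : Euc N → ℝ) (p : ℝ) (Ω : Set (Euc N)) (u : Euc N → ℝ) : Prop where
  contOn : ContinuousOn u (closure Ω)
  diff : ∀ x ∈ Ω, DifferentiableAt ℝ u x
  bdry : ∀ x ∈ frontier Ω, u x = 0
  int_u : IntegrableOn u Ω
  int_grad : IntegrableOn (fun x => H (gradient u x) ^ p) Ω
  weak : ∀ φ : Euc N → ℝ, ContDiff ℝ 1 φ → HasCompactSupport φ → tsupport φ ⊆ Ω →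
    (∫ x in Ω, H (gradient u x) ^ (p - 1) * ⟪gradient H (gradient u x), gradient φ x⟫)
      = ∫ x in Ω, φ x

/-- Solution of the exterior problem: `Δ_p^H u = 0` weakly in `ℝ^N ∖ cl Ω`, `u = 1` on `∂Ω`,
`u → 0` at infinity. -/
structure IsExteriorSol (H : Euc N → ℝ) (p : ℝ) (Ω : Set (Euc N)) (u : Euc N → ℝ) : Prop where
  contOn : ContinuousOn u Ωᶜ
  diff : ∀ x ∈ (closure Ω)ᶜ, DifferentiableAt ℝ u x
  bdry : ∀ x ∈ frontier Ω, u x = 1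
  decay : Tendsto u (cocompact (Euc N)) (𝓝 0)
  weak : ∀ φ : Euc N → ℝ, ContDiff ℝ 1 φ → HasCompactSupport φ → tsupport φ ⊆ (closure Ω)ᶜ →
    (∫ x in (closure Ω)ᶜ,
      H (gradient u x) ^ (p - 1) * ⟪gradient H (gradient u x), gradient φ x⟫) = 0

/-- The inward unit normal field associated to a defining function `f` (with `Ω = {f < 0}`). -/
def inwardField (f : Euc N → ℝ) (x : Euc N) : Euc N := -(‖gradient f x‖)⁻¹ • gradient f x

/-- `ν` is the inward unit normal of `Ω` and `M` its anisotropic mean curvature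
`M = -div(∇_ξ H(ν))`, computed via a `C²` defining function. -/
def IsNormalCurv (H : Euc N → ℝ) (Ω : Set (Euc N)) (ν : Euc N → Euc N) (M : Euc N → ℝ) : Prop :=
  ∃ f : Euc N → ℝ, ContDiff ℝ 2 f ∧ Ω = {x | f x < 0} ∧ frontier Ω = {x | f x = 0} ∧
    (∀ x ∈ frontier Ω, gradient f x ≠ 0) ∧
    (∀ x ∈ frontier Ω, ν x = inwardField f x) ∧
    (∀ x ∈ frontier Ω, M x = - divVF (fun y => gradient H (inwardField f y)) x)

/-- `ν` is the inward unit normal field of `Ω`, computed via a `C²` defining function. -/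
def IsInwardNormal (Ω : Set (Euc N)) (ν : Euc N → Euc N) : Prop :=
  ∃ f : Euc N → ℝ, ContDiff ℝ 2 f ∧ Ω = {x | f x < 0} ∧ frontier Ω = {x | f x = 0} ∧
    (∀ x ∈ frontier Ω, gradient f x ≠ 0) ∧
    ∀ x ∈ frontier Ω, ν x = inwardField f x

/-- Second elementary symmetric function of a matrix. -/
def S2 (A : Matrix (Fin N) (Fin N) ℝ) : ℝ := ((Matrix.trace A) ^ 2 - Matrix.trace (A * A)) / 2

/-- `S²_{ij}(A) = -a_{ji} + δ_{ij} Tr A`. -/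
def S2ij (A : Matrix (Fin N) (Fin N) ℝ) (i j : Fin N) : ℝ :=
  -A j i + (if i = j then Matrix.trace A else 0)

/-- The matrix `W = ∇²_ξ V(Dv) D²v`. -/
def Wmat (H : Euc N → ℝ) (p : ℝ) (v : Euc N → ℝ) (x : Euc N) : Matrix (Fin N) (Fin N) ℝ :=
  hessM (Vfun H p) (gradient v x) * hessM v x

/-- `G` is the weak (distributional) Jacobian matrix of the vector field `Z` on `Ω`, with both
`Z` and `G` square-integrable (i.e. `Z ∈ W^{1,2}(Ω)` with Jacobian `G`). -/
def IsWeakJacobianOn (Z : Euc N → Euc N) (G : Euc N → Matrix (Fin N) (Fin N) ℝ)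
    (Ω : Set (Euc N)) : Prop :=
  IntegrableOn (fun x => ∑ i, (Z x i) ^ 2) Ω ∧
  IntegrableOn (fun x => ∑ i, ∑ j, (G x i j) ^ 2) Ω ∧
  ∀ (i j : Fin N) (φ : Euc N → ℝ), ContDiff ℝ 1 φ → HasCompactSupport φ → tsupport φ ⊆ Ω →
    (∫ x in Ω, Z x i * pd j φ x) = - ∫ x in Ω, G x i j * φ x

/-- The vector field `Z` belongs to `W^{1,2}(Ω)`. -/
def MemW12 (Z : Euc N → Euc N) (Ω : Set (Euc N)) : Prop := ∃ G, IsWeakJacobianOn Z G Ω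


/-- The anisotropic `p`-capacity of `Ω`. -/
def pCapacity (H : Euc N → ℝ) (p : ℝ) (Ω : Set (Euc N)) : ℝ :=
  sInf {r : ℝ | ∃ φ : Euc N → ℝ, ContDiff ℝ (⊤ : ℕ∞) φ ∧ HasCompactSupport φ ∧
    (∀ x ∈ Ω, 1 ≤ φ x) ∧ r = (1 / p) * ∫ x, H (gradient φ x) ^ p}

/-- The `(N-1)`-dimensional Hausdorff (surface) measure on `ℝ^N`. -/
def surf (N : ℕ) : Measure (Euc N) := Measure.hausdorffMeasure ((N : ℝ) - 1)

end

noncomputable section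
open MeasureTheory Filter Set
open scoped Topology RealInnerProductSpace NNReal

section

variable {N : ℕ}

theorem fderiv_smul_of_homogeneous {f : Euc N → ℝ} {t c : ℝ} (ht : t ≠ 0)
    (hf : ∀ x, f (t • x) = c * f x) (x : Euc N) :
    fderiv ℝ f (t • x) = (c / t) • fderiv ℝ f x := by
  have h1 : fderiv ℝ (fun y => f (t • y)) x = t • fderiv ℝ f (t • x) := fderiv_comp_smul t
  have h2 : (fun y => f (t • y)) = c • f := by
    ext y
    simp [hf]
  rw [h2, fderiv_const_smul_field] at h1
  rw [div_eq_inv_mul, mul_smul, ← Pi.smul_apply c, h1, smul_smul, inv_mul_cancel₀ ht, one_smul]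

theorem pd_smul_of_homogeneous {f : Euc N → ℝ} {t c : ℝ} (ht : t ≠ 0)
    (hf : ∀ x, f (t • x) = c * f x) (i : Fin N) (x : Euc N) :
    pd i f (t • x) = c / t * pd i f x := by
  simp [pd, fderiv_smul_of_homogeneous ht hf]

theorem hessM_smul_of_homogeneous {f : Euc N → ℝ} {t c : ℝ} (ht : t ≠ 0)
    (hf : ∀ x, f (t • x) = c * f x) (x : Euc N) :
    hessM f (t • x) = (c / t / t) • hessM f x := by
  ext i j
  simp only [hessM, Matrix.of_apply, Matrix.smul_apply, smul_eq_mul]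
  exact pd_smul_of_homogeneous ht (pd_smul_of_homogeneous ht hf j) i x

theorem gradient_apply_eq_pd (f : Euc N → ℝ) (x : Euc N) (i : Fin N) :
    gradient f x i = pd i f x := by
  rw [pd, ← inner_gradient_left, EuclideanSpace.inner_single_right]
  simp

theorem ContDiffAt.gradient_right {f : Euc N → ℝ} {x : Euc N} (hf : ContDiffAt ℝ 2 f x) :
    ContDiffAt ℝ 1 (gradient f) x :=
  (InnerProductSpace.toDual ℝ (Euc N)).symm.contDiff.contDiffAt.comp x
    (hf.fderiv_right (by norm_num))

theorem hessM_apply_eq_fderiv_gradient {f : Euc N → ℝ} {x : Euc N} (hf : ContDiffAt ℝ 2 f x)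
    (i j : Fin N) :
    hessM f x i j = fderiv ℝ (gradient f) x (EuclideanSpace.single i 1) j := by
  have hd : HasFDerivAt (gradient f) (fderiv ℝ (gradient f) x) x :=
    (hf.gradient_right.differentiableAt (by norm_num)).hasFDerivAt
  have hj := (EuclideanSpace.proj (𝕜 := ℝ) j).hasFDerivAt.comp x hd
  have he : pd j f = (EuclideanSpace.proj (𝕜 := ℝ) j) ∘ gradient f := by
    ext y
    simp [gradient_apply_eq_pd]
  rw [hessM, Matrix.of_apply, he, pd, hj.fderiv]
  simp

theorem sum_smul_single_one (ζ : Euc N) :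
    ∑ i, ζ i • (EuclideanSpace.single i 1 : Euc N) = ζ := by
  ext j
  simp [Finset.sum_apply, Pi.single_apply]

theorem qForm_hessM_eq_inner {f : Euc N → ℝ} {x : Euc N} (hf : ContDiffAt ℝ 2 f x) (ζ : Euc N) :
    qForm (hessM f x) ζ = ⟪fderiv ℝ (gradient f) x ζ, ζ⟫ := by
  conv_rhs => rw [← sum_smul_single_one ζ, map_sum, sum_inner]
  refine Finset.sum_congr rfl fun i _ => ?_
  rw [sum_smul_single_one, map_smul, inner_smul_left, PiLp.inner_apply, Finset.mul_sum]
  refine Finset.sum_congr rfl fun j _ => ?_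
  rw [hessM_apply_eq_fderiv_gradient hf]
  simp
  ring

theorem exists_equiv_of_qForm_hessM {f : Euc N → ℝ} {x : Euc N} (hf : ContDiffAt ℝ 2 f x)
    (hq : ∀ ζ, qForm (hessM f x) ζ = 0 → ζ = 0) :
    ∃ e : Euc N ≃L[ℝ] Euc N, (e : Euc N →L[ℝ] Euc N) = fderiv ℝ (gradient f) x := by
  have hinj : Function.Injective (fderiv ℝ (gradient f) x : Euc N →ₗ[ℝ] Euc N) := by
    refine (injective_iff_map_eq_zero _).2 fun ζ hζ => hq ζ ?_
    rw [qForm_hessM_eq_inner hf]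
    simpa using congrArg (fun v => ⟪v, ζ⟫) hζ
  refine ⟨(LinearEquiv.ofInjectiveEndo _ hinj).toContinuousLinearEquiv, ?_⟩
  ext1 ζ
  rfl

namespace IsIpNorm

variable {p : ℝ} {H : Euc N → ℝ}

theorem map_zero (hH : IsIpNorm p H) : H 0 = 0 := by
  simpa using hH.homog 0 0

theorem nonneg (hH : IsIpNorm p H) (ξ : Euc N) : 0 ≤ H ξ := by
  rcases eq_or_ne ξ 0 with rfl | h
  · exact hH.map_zero.ge
  · exact (hH.pos ξ h).le

theorem add_le (hH : IsIpNorm p H) (ξ ζ : Euc N) : H (ξ + ζ) ≤ H ξ + H ζ := by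
  have h := hH.convex.2 (mem_univ ((2 : ℝ) • ξ)) (mem_univ ((2 : ℝ) • ζ))
    (by norm_num : (0 : ℝ) ≤ 1 / 2) (by norm_num : (0 : ℝ) ≤ 1 / 2) (by norm_num)
  simp only [smul_smul, hH.homog, smul_eq_mul] at h
  norm_num at h
  linarith

theorem abs_sub_le (hH : IsIpNorm p H) (ξ ζ : Euc N) : |H (ξ + ζ) - H ξ| ≤ H ζ := by
  have h1 := hH.add_le ξ ζ
  have h2 := hH.add_le (ξ + ζ) ((-1 : ℝ) • ζ)
  rw [hH.homog] at h2
  have h3 : ξ + ζ + (-1 : ℝ) • ζ = ξ := by module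
  rw [h3] at h2
  norm_num at h2
  rw [abs_le]
  constructor <;> linarith

theorem differentiableAt (hH : IsIpNorm p H) {ξ : Euc N} (hξ : ξ ≠ 0) :
    DifferentiableAt ℝ H ξ :=
  (hH.smooth.contDiffAt (isOpen_compl_singleton.mem_nhds hξ)).differentiableAt (by norm_num)

theorem hasDerivAt_line (hH : IsIpNorm p H) {ξ : Euc N} (hξ : ξ ≠ 0) (ζ : Euc N) :
    HasDerivAt (fun t : ℝ => H (ξ + t • ζ)) (fderiv ℝ H ξ ζ) 0 :=
  (hH.differentiableAt hξ).hasFDerivAt.hasLineDerivAt ζ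

theorem fderiv_apply_le (hH : IsIpNorm p H) {ξ : Euc N} (hξ : ξ ≠ 0) (ζ : Euc N) :
    fderiv ℝ H ξ ζ ≤ H ζ := by
  refine (Real.le_norm_self _).trans ((hH.hasDerivAt_line hξ ζ).le_of_lip' (hH.nonneg ζ) ?_)
  filter_upwards with t
  have h := hH.abs_sub_le ξ (t • ζ)
  rw [hH.homog] at h
  simpa [mul_comm] using h

theorem fderiv_apply_self (hH : IsIpNorm p H) {ξ : Euc N} (hξ : ξ ≠ 0) :
    fderiv ℝ H ξ ξ = H ξ := by
  refine (hH.hasDerivAt_line hξ ξ).unique ?_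
  have h : HasDerivAt (fun t : ℝ => (1 + t) * H ξ) (1 * H ξ) 0 :=
    ((hasDerivAt_id (0 : ℝ)).const_add 1).mul_const _
  rw [one_mul] at h
  refine h.congr_of_eventuallyEq ?_
  filter_upwards [lt_mem_nhds (by norm_num : (-1 : ℝ) < 0)] with t ht
  have he : ξ + t • ξ = (1 + t) • ξ := by module
  rw [he, hH.homog, abs_of_pos (by linarith)]

theorem inner_gradient_Vfun (hH : IsIpNorm p H) (hp : 1 < p) {ξ : Euc N} (hξ : ξ ≠ 0)
    (ζ : Euc N) : ⟪gradient (Vfun H p) ξ, ζ⟫ = H ξ ^ (p - 1) * fderiv ℝ H ξ ζ := by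
  have h := ((hH.differentiableAt hξ).hasFDerivAt.rpow_const (p := p)
    (Or.inl (hH.pos ξ hξ).ne')).mul_const p⁻¹
  rw [inner_gradient_left, (h.congr_of_eventuallyEq (f₁ := Vfun H p)
    (Eventually.of_forall fun x => div_eq_mul_inv (H x ^ p) p)).fderiv]
  have : p ≠ 0 := by linarith
  simp
  field_simp

theorem inner_gradient_Vfun_le (hH : IsIpNorm p H) (hp : 1 < p) {ξ : Euc N} (hξ : ξ ≠ 0)
    (ζ : Euc N) : ⟪gradient (Vfun H p) ξ, ζ⟫ ≤ H ξ ^ (p - 1) * H ζ := by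
  rw [hH.inner_gradient_Vfun hp hξ]
  exact mul_le_mul_of_nonneg_left (hH.fderiv_apply_le hξ ζ) (Real.rpow_nonneg (hH.nonneg ξ) _)

theorem inner_gradient_Vfun_div_le (hH : IsIpNorm p H) (hp : 1 < p) {ξ : Euc N} (hξ : ξ ≠ 0)
    (ζ : {ζ : Euc N // ζ ≠ 0}) :
    ⟪gradient (Vfun H p) ξ, (ζ : Euc N)⟫ / H ζ ≤ H ξ ^ (p - 1) :=
  (div_le_iff₀ (hH.pos ζ ζ.2)).2 (hH.inner_gradient_Vfun_le hp hξ ζ)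

theorem le_dualNorm_gradient_Vfun (hH : IsIpNorm p H) (hp : 1 < p) {ξ ζ : Euc N} (hξ : ξ ≠ 0)
    (hζ : ζ ≠ 0) :
    ⟪gradient (Vfun H p) ξ, ζ⟫ / H ζ ≤ dualNorm H (gradient (Vfun H p) ξ) :=
  le_ciSup (f := fun ζ : {ζ : Euc N // ζ ≠ 0} => ⟪gradient (Vfun H p) ξ, (ζ : Euc N)⟫ / H ζ)
    ⟨H ξ ^ (p - 1), by rintro _ ⟨ζ, rfl⟩; exact hH.inner_gradient_Vfun_div_le hp hξ ζ⟩ ⟨ζ, hζ⟩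

theorem inner_gradient_Vfun_self_div (hH : IsIpNorm p H) (hp : 1 < p) {ξ : Euc N} (hξ : ξ ≠ 0) :
    ⟪gradient (Vfun H p) ξ, ξ⟫ / H ξ = H ξ ^ (p - 1) := by
  rw [hH.inner_gradient_Vfun hp hξ, hH.fderiv_apply_self hξ,
    mul_div_cancel_right₀ _ (hH.pos ξ hξ).ne']

theorem dualNorm_gradient_Vfun (hH : IsIpNorm p H) (hp : 1 < p) {ξ : Euc N} (hξ : ξ ≠ 0) :
    dualNorm H (gradient (Vfun H p) ξ) = H ξ ^ (p - 1) := by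
  have : Nonempty {ζ : Euc N // ζ ≠ 0} := ⟨⟨ξ, hξ⟩⟩
  refine le_antisymm (ciSup_le (hH.inner_gradient_Vfun_div_le hp hξ)) ?_
  rw [← hH.inner_gradient_Vfun_self_div hp hξ]
  exact hH.le_dualNorm_gradient_Vfun hp hξ hξ

theorem Vfun_smul (hH : IsIpNorm p H) (t : ℝ) (ξ : Euc N) :
    Vfun H p (t • ξ) = |t| ^ p * Vfun H p ξ := by
  rw [Vfun, Vfun, hH.homog, Real.mul_rpow (abs_nonneg t) (hH.nonneg ξ), mul_div_assoc]

theorem contDiffAt_Vfun (hH : IsIpNorm p H) {ξ : Euc N} (hξ : ξ ≠ 0) :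
    ContDiffAt ℝ 2 (Vfun H p) ξ :=
  hH.Vsmooth.contDiffAt (isOpen_compl_singleton.mem_nhds hξ)

theorem eq_zero_of_qForm_hessM_Vfun (hH : IsIpNorm p H) {ξ : Euc N} (hξ : ξ ≠ 0) {ζ : Euc N}
    (h : qForm (hessM (Vfun H p) ξ) ζ = 0) : ζ = 0 := by
  obtain ⟨c, hc, hpos⟩ := hH.hessV_pos
  have ht : ‖ξ‖⁻¹ ≠ 0 := inv_ne_zero (norm_ne_zero_iff.2 hξ)
  have hle := hpos (‖ξ‖⁻¹ • ξ) (norm_smul_inv_norm (𝕜 := ℝ) hξ) ζ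
  rw [hessM_smul_of_homogeneous ht (hH.Vfun_smul _)] at hle
  have hq (k : ℝ) (A : Matrix (Fin N) (Fin N) ℝ) : qForm (k • A) ζ = k * qForm A ζ := by
    simp [qForm, Finset.mul_sum, mul_assoc]
  rw [hq, h, mul_zero] at hle
  by_contra hζ
  have := norm_pos_iff.2 hζ
  have : 0 < c * ‖ζ‖ ^ 2 := by positivity
  linarith

/-- Near a point `∇V(ξ)`, the map `∇V` has a differentiable local inverse `ψ`, and
`∇H₀ = ψ / H(ψ)`. -/
theorem exists_localInverse_gradient_Vfun (hH : IsIpNorm p H) (hp : 1 < p) {ξ : Euc N}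
    (hξ : ξ ≠ 0) {e : Euc N ≃L[ℝ] Euc N}
    (he : (e : Euc N →L[ℝ] Euc N) = fderiv ℝ (gradient (Vfun H p)) ξ) :
    ∃ ψ : Euc N → Euc N, ψ (gradient (Vfun H p) ξ) = ξ ∧
      HasFDerivAt ψ (e.symm : Euc N →L[ℝ] Euc N) (gradient (Vfun H p) ξ) ∧
      dualNorm H =ᶠ[𝓝 (gradient (Vfun H p) ξ)] (fun y => H (ψ y) ^ (p - 1)) ∧
      ∀ᶠ y in 𝓝 (gradient (Vfun H p) ξ), ∀ ζ,
        fderiv ℝ (dualNorm H) y ζ = ⟪ψ y, ζ⟫ / H (ψ y) := by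
  have hG := (hH.contDiffAt_Vfun hξ).gradient_right
  have hd : HasFDerivAt (gradient (Vfun H p)) (e : Euc N →L[ℝ] Euc N) ξ := by
    rw [he]
    exact (hG.differentiableAt (by norm_num)).hasFDerivAt
  have hs := hG.hasStrictFDerivAt' hd (by norm_num)
  set x₀ := gradient (Vfun H p) ξ
  set ψ := hG.localInverse hd (by norm_num)
  have hψ0 : ψ x₀ = ξ := hG.localInverse_apply_image hd (by norm_num)
  have hψ1 : ContDiffAt ℝ 1 ψ x₀ := hG.to_localInverse hd (by norm_num)
  have hψ' : HasFDerivAt ψ (e.symm : Euc N →L[ℝ] Euc N) x₀ := hs.to_localInverse.hasFDerivAt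
  have hinv : ∀ᶠ y in 𝓝 x₀, gradient (Vfun H p) (ψ y) = y := hs.eventually_right_inverse
  have hne : ∀ᶠ y in 𝓝 x₀, ψ y ≠ 0 :=
    hψ1.continuousAt.eventually_ne (by rwa [hψ0])
  have hdiff : ∀ᶠ y in 𝓝 x₀, DifferentiableAt ℝ ψ y :=
    (hψ1.eventually (by simp)).mono fun y hy => hy.differentiableAt (by norm_num)
  have hval : dualNorm H =ᶠ[𝓝 x₀] (fun y => H (ψ y) ^ (p - 1)) := by
    filter_upwards [hinv, hne] with y h1 h2
    conv_lhs => rw [← h1]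
    exact hH.dualNorm_gradient_Vfun hp h2
  refine ⟨ψ, hψ0, hψ', hval, ?_⟩
  filter_upwards [hval.eventually_nhds, hinv.eventually_nhds, hne.eventually_nhds, hdiff]
    with y h1 h2 h3 h4 ζ
  have hy0 : ψ y ≠ 0 := h3.self_of_nhds
  have hdd : DifferentiableAt ℝ (dualNorm H) y :=
    ((((hH.differentiableAt hy0).comp y h4).rpow_const
      (Or.inl (hH.pos _ hy0).ne'))).congr_of_eventuallyEq h1
  have hlin : HasFDerivAt (fun z : Euc N => ⟪z, ψ y⟫ / H (ψ y))
      ((H (ψ y))⁻¹ • innerSL ℝ (ψ y)) y := by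
    have := ((innerSL ℝ (ψ y)).hasFDerivAt (x := y)).const_smul (H (ψ y))⁻¹
    refine this.congr_of_eventuallyEq (Eventually.of_forall fun z => ?_)
    simp [real_inner_comm, div_eq_inv_mul]
  have hmin : IsLocalMin (fun z => dualNorm H z - ⟪z, ψ y⟫ / H (ψ y)) y := by
    have hy : dualNorm H y - ⟪y, ψ y⟫ / H (ψ y) = 0 := by
      have h := hH.inner_gradient_Vfun_self_div hp hy0
      rw [h2.self_of_nhds] at h
      rw [h, h1.self_of_nhds, sub_self]
    filter_upwards [h2, h3] with z hz hz0
    rw [hy, sub_nonneg]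
    have := hH.le_dualNorm_gradient_Vfun hp hz0 hy0
    rwa [hz] at this
  have hzero := hmin.hasFDerivAt_eq_zero (hdd.hasFDerivAt.sub hlin)
  rw [sub_eq_zero.1 hzero]
  simp [div_eq_inv_mul]

theorem hessM_Vfun_mul_of_eq_one (hH : IsIpNorm p H) (hp : 1 < p) {ξ : Euc N} (hξ : ξ ≠ 0)
    (h1 : H ξ = 1) :
    hessM (Vfun H p) ξ *
        (Matrix.of fun i j => (p - 1)⁻¹ *
          (pd i (dualNorm H) (gradient H ξ) * pd j (dualNorm H) (gradient H ξ)
            + (p - 1) * hessM (dualNorm H) (gradient H ξ) i j)) = 1 := by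
  have hp1 : p - 1 ≠ 0 := by linarith
  have hgrad : gradient H ξ = gradient (Vfun H p) ξ := by
    refine ext_inner_right ℝ fun ζ => ?_
    rw [hH.inner_gradient_Vfun hp hξ, h1, Real.one_rpow, one_mul, inner_gradient_left]
  obtain ⟨e, he⟩ := exists_equiv_of_qForm_hessM (hH.contDiffAt_Vfun hξ)
    fun ζ => hH.eq_zero_of_qForm_hessM_Vfun hξ
  obtain ⟨ψ, hψ0, hψ', hval, hder⟩ := hH.exists_localInverse_gradient_Vfun hp hξ he
  rw [hgrad]
  set x₀ := gradient (Vfun H p) ξ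
  have hHψ : HasFDerivAt (fun y => H (ψ y)) (fderiv ℝ H ξ ∘L (e.symm : Euc N →L[ℝ] Euc N)) x₀ := by
    refine HasFDerivAt.comp x₀ ?_ hψ'
    rw [hψ0]
    exact (hH.differentiableAt hξ).hasFDerivAt
  have hfirst (i : Fin N) : pd i (dualNorm H) x₀ = ξ i := by
    rw [pd, hder.self_of_nhds, hψ0, h1]
    simp [EuclideanSpace.inner_single_right]
  have hDH (i : Fin N) :
      fderiv ℝ H ξ (e.symm (EuclideanSpace.single i 1)) = (p - 1)⁻¹ * ξ i := by
    have h := (hHψ.rpow_const (p := p - 1) (Or.inl (by simp [hψ0, h1]))).congr_of_eventuallyEq hval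
    have h' := hfirst i
    rw [pd, h.fderiv] at h'
    simp [hψ0, h1] at h'
    rw [← h', inv_mul_cancel_left₀ hp1]
  have hsecond (i j : Fin N) : hessM (dualNorm H) x₀ i j =
      e.symm (EuclideanSpace.single i 1) j - (p - 1)⁻¹ * (ξ i * ξ j) := by
    have hev : pd j (dualNorm H) =ᶠ[𝓝 x₀] fun y => ψ y j * H (ψ y) ^ (-1 : ℝ) := by
      filter_upwards [hder] with y hy
      rw [pd, hy, Real.rpow_neg_one]
      simp [EuclideanSpace.inner_single_right, div_eq_mul_inv]
    have hj : HasFDerivAt (fun y => ψ y j)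
        (EuclideanSpace.proj (𝕜 := ℝ) j ∘L (e.symm : Euc N →L[ℝ] Euc N)) x₀ :=
      (EuclideanSpace.proj (𝕜 := ℝ) j).hasFDerivAt.comp x₀ hψ'
    have hquot := (hj.mul (hHψ.rpow_const (p := -1) (Or.inl (by simp [hψ0, h1])))).congr_of_eventuallyEq hev
    rw [hessM, Matrix.of_apply, pd, hquot.fderiv]
    simp [hψ0, h1, hDH]
    ring
  ext i j
  have hentry (k : Fin N) : (p - 1)⁻¹ * (pd k (dualNorm H) x₀ * pd j (dualNorm H) x₀
      + (p - 1) * hessM (dualNorm H) x₀ k j) = e.symm (EuclideanSpace.single k 1) j := by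
    rw [hfirst, hfirst, hsecond]
    field_simp
    ring
  simp only [Matrix.mul_apply, Matrix.of_apply, hentry]
  calc ∑ k, hessM (Vfun H p) ξ i k * e.symm (EuclideanSpace.single k 1) j
      = e.symm (∑ k, e (EuclideanSpace.single i 1) k • (EuclideanSpace.single k 1 : Euc N)) j := by
        rw [map_sum]
        simp [hessM_apply_eq_fderiv_gradient (hH.contDiffAt_Vfun hξ), ← he]
    _ = (1 : Matrix (Fin N) (Fin N) ℝ) i j := by
        rw [sum_smul_single_one, e.symm_apply_apply]
        simp [Matrix.one_apply, eq_comm]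

end IsIpNorm

end

theorem inverse_hessian_of_V
    {N : ℕ} {p : ℝ} (hp : 1 < p) {H : Euc N → ℝ} (hH : IsIpNorm p H)
    (ξ : Euc N) (hξ : ξ ≠ 0) :
    hessM (Vfun H p) ξ *
        (Matrix.of fun i j => (H ξ ^ (2 - p) / (p - 1)) *
          (pd i (dualNorm H) (gradient H ξ) * pd j (dualNorm H) (gradient H ξ)
            + (p - 1) * hessM (dualNorm H) (gradient H ξ) i j)) = 1 ∧
      (Matrix.of fun i j => (H ξ ^ (2 - p) / (p - 1)) *
          (pd i (dualNorm H) (gradient H ξ) * pd j (dualNorm H) (gradient H ξ)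
            + (p - 1) * hessM (dualNorm H) (gradient H ξ) i j)) *
        hessM (Vfun H p) ξ = 1 := by
  suffices h : hessM (Vfun H p) ξ *
        (Matrix.of fun i j => (H ξ ^ (2 - p) / (p - 1)) *
          (pd i (dualNorm H) (gradient H ξ) * pd j (dualNorm H) (gradient H ξ)
            + (p - 1) * hessM (dualNorm H) (gradient H ξ) i j)) = 1 from
    ⟨h, mul_eq_one_comm.1 h⟩
  have hpos := hH.pos ξ hξ
  have ht : (H ξ)⁻¹ ≠ 0 := inv_ne_zero hpos.ne'
  have habs : |(H ξ)⁻¹| = (H ξ)⁻¹ := abs_of_pos (inv_pos.2 hpos)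
  have hgrad : gradient H ((H ξ)⁻¹ • ξ) = gradient H ξ := by
    refine ext_inner_right ℝ fun ζ => ?_
    rw [inner_gradient_left, inner_gradient_left,
      fderiv_smul_of_homogeneous ht (hH.homog _), habs, div_self ht, one_smul]
  have hhess : hessM (Vfun H p) ((H ξ)⁻¹ • ξ) = H ξ ^ (2 - p) • hessM (Vfun H p) ξ := by
    rw [hessM_smul_of_homogeneous ht (hH.Vfun_smul _), habs, Real.inv_rpow hpos.le,
      Real.rpow_sub hpos, Real.rpow_two]
    congr 1
    field_simp
  have hone : H ((H ξ)⁻¹ • ξ) = 1 := by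
    rw [hH.homog, habs, inv_mul_cancel₀ hpos.ne']
  have h := hH.hessM_Vfun_mul_of_eq_one hp (smul_ne_zero ht hξ) hone
  rw [hgrad, hhess, Matrix.smul_mul, ← Matrix.mul_smul] at h
  rw [← h]
  congr 1
  ext i j
  simp only [Matrix.smul_apply, Matrix.of_apply, smul_eq_mul]
  ring

end
end

section
/- Let B and C be symmetric N×N real matrices with B positive semidefinite, and set A = BC. Then S_2(A) ≤ ((N−1)/(2N)) (Tr A)². Moreover, if Tr(A) ≠ 0 and equality holds, then A = (Tr(A)/N)·I and B is positive definite. -/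
open MeasureTheory Filter Set
open scoped Topology RealInnerProductSpace NNReal

noncomputable section
open MeasureTheory Filter Set
open scoped Topology RealInnerProductSpace NNReal

/-- The squared Frobenius distance of a symmetric matrix to its scalar part. -/
theorem trace_transpose_mul_self_sub_scalar {N : ℕ} (hN : 1 ≤ N)
    {P : Matrix (Fin N) (Fin N) ℝ} (hP : P.IsSymm) :
    Matrix.trace ((P - (P.trace / N) • (1 : Matrix (Fin N) (Fin N) ℝ)).transpose *
      (P - (P.trace / N) • (1 : Matrix (Fin N) (Fin N) ℝ))) =
      Matrix.trace (P * P) - P.trace ^ 2 / N := by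
  have hN0 : (N : ℝ) ≠ 0 := by positivity
  simp only [Matrix.transpose_sub, Matrix.transpose_smul, Matrix.transpose_one, hP.eq, sub_mul,
    mul_sub, Matrix.smul_mul, Matrix.mul_smul, one_mul, mul_one, Matrix.trace_sub,
    Matrix.trace_smul, Matrix.trace_one, Fintype.card_fin, smul_eq_mul]
  field_simp
  ring

theorem trace_transpose_mul_self_nonneg {N : ℕ} (Q : Matrix (Fin N) (Fin N) ℝ) :
    0 ≤ Matrix.trace (Q.transpose * Q) := by
  simpa using (Matrix.posSemidef_conjTranspose_mul_self Q).trace_nonneg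

/-- Newton-type inequality. -/
theorem newton_inequality_product
    {N : ℕ} (hN : 1 ≤ N) (B C : Matrix (Fin N) (Fin N) ℝ)
    (hB : B.IsSymm) (hC : C.IsSymm) (hBpsd : B.PosSemidef) :
    S2 (B * C) ≤ ((N : ℝ) - 1) / (2 * N) * (Matrix.trace (B * C)) ^ 2 ∧
      (Matrix.trace (B * C) ≠ 0 →
        S2 (B * C) = ((N : ℝ) - 1) / (2 * N) * (Matrix.trace (B * C)) ^ 2 →
        B * C = (Matrix.trace (B * C) / N) • (1 : Matrix (Fin N) (Fin N) ℝ) ∧ B.PosDef) := by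
  have hN0 : (N : ℝ) ≠ 0 := by positivity
  obtain ⟨R, hR⟩ : ∃ R : Matrix (Fin N) (Fin N) ℝ, B = R.transpose * R := by
    open scoped MatrixOrder in
    obtain ⟨R, hR⟩ := CStarAlgebra.nonneg_iff_eq_star_mul_self.mp hBpsd.nonneg
    exact ⟨R, by simpa [Matrix.star_eq_conjTranspose] using hR⟩
  set P := R * C * R.transpose with hPdef
  have hP : P.IsSymm := by
    simp [Matrix.IsSymm, hPdef, Matrix.transpose_mul, hC.eq, mul_assoc]
  have htr : Matrix.trace (B * C) = P.trace := by
    rw [hR, mul_assoc, Matrix.trace_mul_comm]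
  have htr2 : Matrix.trace (B * C * (B * C)) = Matrix.trace (P * P) := by
    rw [hR, show R.transpose * R * C * (R.transpose * R * C) =
      R.transpose * (R * C * (R.transpose * R * C)) by simp only [mul_assoc],
      Matrix.trace_mul_comm]
    simp only [hPdef, mul_assoc]
  have hS : ((N : ℝ) - 1) / (2 * N) * (Matrix.trace (B * C)) ^ 2 - S2 (B * C) =
      (Matrix.trace (P * P) - P.trace ^ 2 / N) / 2 := by
    rw [S2, htr, htr2]
    field_simp
    ring
  rw [← trace_transpose_mul_self_sub_scalar hN hP] at hS
  refine ⟨?_, fun ht heq => ?_⟩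
  · linarith [trace_transpose_mul_self_nonneg
      (P - (P.trace / N) • (1 : Matrix (Fin N) (Fin N) ℝ))]
  rw [htr] at ht ⊢
  rw [heq, sub_self] at hS
  have hs : P.trace / N ≠ 0 := div_ne_zero ht hN0
  have hPs : P = (P.trace / N) • (1 : Matrix (Fin N) (Fin N) ℝ) := by
    rw [← sub_eq_zero, ← Matrix.trace_conjTranspose_mul_self_eq_zero_iff,
      Matrix.conjTranspose_eq_transpose_of_trivial]
    linarith
  generalize P.trace / N = s at hs hPs ⊢
  have hinv : R * (s⁻¹ • (C * R.transpose)) = 1 := by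
    rw [Matrix.mul_smul, ← mul_assoc, ← hPdef, hPs, smul_smul, inv_mul_cancel₀ hs, one_smul]
  have hCB : s⁻¹ • (C * B) = 1 := by
    rw [hR, ← mul_assoc, ← Matrix.smul_mul]
    exact mul_eq_one_comm.mp hinv
  have hBC : s⁻¹ • (B * C) = 1 := by
    simpa [Matrix.transpose_mul, hB.eq, hC.eq] using congrArg Matrix.transpose hCB
  refine ⟨by rw [← hBC, smul_smul, mul_inv_cancel₀ hs, one_smul], ?_⟩
  rw [hBpsd.posDef_iff_isUnit]
  exact IsUnit.of_mul_eq_one (s⁻¹ • C) (by rw [Matrix.mul_smul, hBC])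

end
end
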